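/- arXiv:2310.14941 — 4 statements merged into one kernel-verified Lean document; each statement's English description precedes it below -/
import Mathlib

section
/- Proposition 3 (same-node case splitting to different nodes). Suppose Assumption 1 holds. If l_i ⪯_= l_j (both routes of each label ending at the same node), then for every link k and every candidate label l ∈ l_j ⊕ k there exists a candidate label l' ∈ l_i ⊕ k such that l' ⪯_≠ l. -/
/-- Different-node comparison: `l_i ⪯_≠ l_j` iff both traits compare. -/
def precNe {T : Type*} (rel : T → T → Prop) (li lj : T × T) : Prop :=
  rel li.1 lj.1 ∧ rel li.2 lj.2

/-- Normal comparison `⪯_n`. -/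
def precN {T : Type*} (rel : T → T → Prop) (li lj : T × T) : Prop :=
  rel li.1 lj.1 ∧ rel li.2 lj.2

/-- Cross comparison `⪯_x`. -/
def precX {T : Type*} (rel : T → T → Prop) (li lj : T × T) : Prop :=
  rel li.1 lj.2 ∧ rel li.2 lj.1

/-- Same-node comparison `⪯_=`: normal or cross. -/
def precEq {T : Type*} (rel : T → T → Prop) (li lj : T × T) : Prop :=
  precN rel li lj ∨ precX rel li lj

/-- Appending link `k` to either route of a same-node label `l = (a, b)`:
`l ⊕ k = {(t, b) : t ∈ a ⊕ k} ∪ {(t, a) : t ∈ b ⊕ k}`. -/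
def oplusBoth {T K : Type*} (oplus : T → K → Set T) (l : T × T) (k : K) : Set (T × T) :=
  ((fun t => (t, l.2)) '' oplus l.1 k) ∪ ((fun t => (t, l.1)) '' oplus l.2 k)

/-- Assumption 1: an inefficient trait yields inefficient traits. -/
def Assumption1 {T K : Type*} (rel : T → T → Prop) (oplus : T → K → Set T) : Prop :=
  ∀ ti tj, rel ti tj → ∀ k, ∀ t ∈ oplus tj k, ∃ t' ∈ oplus ti k, rel t' t

/-- Proposition 3 (same-node case splitting to different nodes). -/
theorem prop3 {T K : Type*} (rel : T → T → Prop) (oplus : T → K → Set T)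
    (h1 : Assumption1 rel oplus)
    (li lj : T × T) (hij : precEq rel li lj) :
    ∀ k : K, ∀ l ∈ oplusBoth oplus lj k, ∃ l' ∈ oplusBoth oplus li k, precNe rel l' l := by
  rintro k l (⟨t, ht, rfl⟩ | ⟨t, ht, rfl⟩) <;> rcases hij with ⟨ha, hb⟩ | ⟨ha, hb⟩
  · obtain ⟨t', ht', h⟩ := h1 _ _ ha k t ht
    exact ⟨_, Or.inl ⟨t', ht', rfl⟩, h, hb⟩
  · obtain ⟨t', ht', h⟩ := h1 _ _ hb k t ht
    exact ⟨_, Or.inr ⟨t', ht', rfl⟩, h, ha⟩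
  · obtain ⟨t', ht', h⟩ := h1 _ _ hb k t ht
    exact ⟨_, Or.inr ⟨t', ht', rfl⟩, h, ha⟩
  · obtain ⟨t', ht', h⟩ := h1 _ _ ha k t ht
    exact ⟨_, Or.inl ⟨t', ht', rfl⟩, h, hb⟩
end

section
/- Proposition 6 (primed same-node case splitting to different nodes). Suppose Assumption 2 and the resource assumption hold. If l_i ⪯'_= l_j (both routes of each label ending at the same node), then for every link k and every candidate label l ∈ l_j ⊕ k there exists a candidate label l' ∈ l_i ⊕ k such that l' ⪯'_≠ l. -/
/-- Appending link `k` to the first route of label `l = (a, b)`: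
`l ⊕₁ k = {(t, b) : t ∈ a ⊕ k}`. -/
def oplus1 {T K : Type*} (oplus : T → K → Set T) (l : T × T) (k : K) : Set (T × T) :=
  (fun t => (t, l.2)) '' oplus l.1 k

/-- `RI(l_i) ⊇_≠ RI(l_j)`: componentwise resource inclusion. -/
def RIsupNe {T : Type*} (RI : T → Set ℤ) (li lj : T × T) : Prop :=
  RI lj.1 ⊆ RI li.1 ∧ RI lj.2 ⊆ RI li.2

/-- `RI(l_i) ⊇_n RI(l_j)`: normal resource inclusion. -/
def RIsupN {T : Type*} (RI : T → Set ℤ) (li lj : T × T) : Prop :=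
  RI lj.1 ⊆ RI li.1 ∧ RI lj.2 ⊆ RI li.2

/-- `RI(l_i) ⊇_x RI(l_j)`: cross resource inclusion. -/
def RIsupX {T : Type*} (RI : T → Set ℤ) (li lj : T × T) : Prop :=
  RI lj.2 ⊆ RI li.1 ∧ RI lj.1 ⊆ RI li.2

/-- `RI(l_i) ⊇_= RI(l_j)`: normal or cross resource inclusion. -/
def RIsupEq {T : Type*} (RI : T → Set ℤ) (li lj : T × T) : Prop :=
  RIsupN RI li lj ∨ RIsupX RI li lj

/-- `l_i ⪯'_≠ l_j`. -/
def precNe' {T : Type*} (cost : T × T → ℝ) (RI : T → Set ℤ) (li lj : T × T) : Prop :=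
  cost li ≤ cost lj ∧ RIsupNe RI li lj

/-- `l_i ⪯'_= l_j`. -/
def precEq' {T : Type*} (cost : T × T → ℝ) (RI : T → Set ℤ) (li lj : T × T) : Prop :=
  cost li ≤ cost lj ∧ RIsupEq RI li lj

/-- Assumption 2: a label of higher cost yields labels of higher cost, for either
link-append operation. -/
def Assumption2 {T K : Type*} (cost : T × T → ℝ) (oplus : T → K → Set T) : Prop :=
  ∀ li lj : T × T, cost li ≤ cost lj → ∀ k : K,
    (∀ l' ∈ oplus1 oplus li k, ∀ l ∈ oplus1 oplus lj k, cost l' ≤ cost l) ∧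
    (∀ l' ∈ oplusBoth oplus li k, ∀ l ∈ oplusBoth oplus lj k, cost l' ≤ cost l)

/-- Resource assumption: a trait with larger resources yields, upon appending any
link, traits with larger resources. -/
def ResourceAssumption {T K : Type*} (RI : T → Set ℤ) (oplus : T → K → Set T) : Prop :=
  ∀ ti tj : T, RI tj ⊆ RI ti → ∀ k : K, ∀ t ∈ oplus tj k, ∃ t' ∈ oplus ti k, RI t ⊆ RI t'

/-- Proposition 6 (primed same-node case splitting to different nodes). -/
theorem prop6 {T K : Type*} (cost : T × T → ℝ) (RI : T → Set ℤ) (oplus : T → K → Set T)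
    (h2 : Assumption2 cost oplus) (hres : ResourceAssumption RI oplus)
    (li lj : T × T) (hij : precEq' cost RI li lj) :
    ∀ k : K, ∀ l ∈ oplusBoth oplus lj k, ∃ l' ∈ oplusBoth oplus li k, precNe' cost RI l' l := by
  intro k l hl
  suffices h : ∃ l' ∈ oplusBoth oplus li k, RIsupNe RI l' l by
    obtain ⟨l', hl', hRI⟩ := h
    exact ⟨l', hl', (h2 li lj hij.1 k).2 l' hl' l hl, hRI⟩
  rcases hl with ⟨t, ht, rfl⟩ | ⟨t, ht, rfl⟩ <;> rcases hij.2 with h | h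
  · obtain ⟨t', ht', hsub⟩ := hres _ _ h.1 k t ht
    exact ⟨_, Or.inl ⟨t', ht', rfl⟩, hsub, h.2⟩
  · obtain ⟨t', ht', hsub⟩ := hres _ _ h.2 k t ht
    exact ⟨_, Or.inr ⟨t', ht', rfl⟩, hsub, h.1⟩
  · obtain ⟨t', ht', hsub⟩ := hres _ _ h.2 k t ht
    exact ⟨_, Or.inr ⟨t', ht', rfl⟩, hsub, h.1⟩
  · obtain ⟨t', ht', hsub⟩ := hres _ _ h.1 k t ht
    exact ⟨_, Or.inl ⟨t', ht', rfl⟩, hsub, h.2⟩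
end

section
/- Proposition 7 (an inefficient label yields inefficient labels). Suppose Assumption 2 and the resource assumption hold. Then in each of the three cases: (i) if l_i ⪯'_≠ l_j, then for every link k and every l ∈ l_j ⊕₁ k there exists l' ∈ l_i ⊕₁ k with l' ⪯'_≠ l; (ii) if l_i ⪯'_≠ l_j, then for every link k and every l ∈ l_j ⊕₁ k there exists l' ∈ l_i ⊕₁ k with l' ⪯'_= l; (iii) if l_i ⪯'_= l_j, then for every link k and every l ∈ l_j ⊕ k there exists l' ∈ l_i ⊕ k with l' ⪯'_≠ l. -/
/-- Better resources of both traits are kept when a link is appended to the first route. -/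
theorem exists_oplus1_RIsupNe {T K : Type*} {RI : T → Set ℤ} {oplus : T → K → Set T}
    (hres : ResourceAssumption RI oplus) {li lj : T × T} (h : RIsupNe RI li lj) {k : K}
    {l : T × T} (hl : l ∈ oplus1 oplus lj k) : ∃ l' ∈ oplus1 oplus li k, RIsupNe RI l' l := by
  obtain ⟨t, ht, rfl⟩ := hl
  obtain ⟨t', ht', hsub⟩ := hres _ _ h.1 k t ht
  exact ⟨_, ⟨t', ht', rfl⟩, hsub, h.2⟩

/-- Appending to either route is appending to the first route of the label or of its swap. -/
theorem oplusBoth_eq_union_swap {T K : Type*} (oplus : T → K → Set T) (l : T × T) (k : K) :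
    oplusBoth oplus l k = oplus1 oplus l k ∪ oplus1 oplus l.swap k :=
  rfl

/-- Better resources, normal or cross, are kept when a link is appended to either route. -/
theorem exists_oplusBoth_RIsupNe {T K : Type*} {RI : T → Set ℤ} {oplus : T → K → Set T}
    (hres : ResourceAssumption RI oplus) {li lj : T × T} (h : RIsupEq RI li lj) {k : K}
    {l : T × T} (hl : l ∈ oplusBoth oplus lj k) :
    ∃ l' ∈ oplusBoth oplus li k, RIsupNe RI l' l := by
  simp only [oplusBoth_eq_union_swap] at hl ⊢
  rcases h with h | h <;> rcases hl with hl | hl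
  · obtain ⟨l', hl', hRI⟩ := exists_oplus1_RIsupNe hres (li := li) h hl
    exact ⟨l', Or.inl hl', hRI⟩
  · obtain ⟨l', hl', hRI⟩ := exists_oplus1_RIsupNe hres (li := li.swap) ⟨h.2, h.1⟩ hl
    exact ⟨l', Or.inr hl', hRI⟩
  · obtain ⟨l', hl', hRI⟩ := exists_oplus1_RIsupNe hres (li := li.swap) ⟨h.2, h.1⟩ hl
    exact ⟨l', Or.inr hl', hRI⟩
  · obtain ⟨l', hl', hRI⟩ := exists_oplus1_RIsupNe hres (li := li) ⟨h.1, h.2⟩ hl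
    exact ⟨l', Or.inl hl', hRI⟩

/-- Proposition 7 (an inefficient label yields inefficient labels): the three cases. -/
theorem prop7 {T K : Type*} (cost : T × T → ℝ) (RI : T → Set ℤ) (oplus : T → K → Set T)
    (h2 : Assumption2 cost oplus) (hres : ResourceAssumption RI oplus) :
    (∀ li lj : T × T, precNe' cost RI li lj →
      ∀ k : K, ∀ l ∈ oplus1 oplus lj k, ∃ l' ∈ oplus1 oplus li k, precNe' cost RI l' l) ∧
    (∀ li lj : T × T, precNe' cost RI li lj →
      ∀ k : K, ∀ l ∈ oplus1 oplus lj k, ∃ l' ∈ oplus1 oplus li k, precEq' cost RI l' l) ∧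
    (∀ li lj : T × T, precEq' cost RI li lj →
      ∀ k : K, ∀ l ∈ oplusBoth oplus lj k, ∃ l' ∈ oplusBoth oplus li k, precNe' cost RI l' l) := by
  refine ⟨fun li lj h k l hl => ?_, fun li lj h k l hl => ?_, fun li lj h k l hl => ?_⟩
  · obtain ⟨l', hl', hRI⟩ := exists_oplus1_RIsupNe hres h.2 hl
    exact ⟨l', hl', (h2 li lj h.1 k).1 l' hl' l hl, hRI⟩
  · obtain ⟨l', hl', hRI⟩ := exists_oplus1_RIsupNe hres h.2 hl
    exact ⟨l', hl', (h2 li lj h.1 k).1 l' hl' l hl, Or.inl hRI⟩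
  · obtain ⟨l', hl', hRI⟩ := exists_oplusBoth_RIsupNe hres h.2 hl
    exact ⟨l', hl', (h2 li lj h.1 k).2 l' hl' l hl, hRI⟩
end

section
/- Lemma 1 (efficient substructure, contrapositive core). Suppose Assumption 2 and the resource assumption hold. Let S_x be a set of labels (the labels of all paths reaching vertex x). If l_i ⪯'_≠ l_j and every candidate label in l_i ⊕₁ k belongs to S_x, then every candidate label l ∈ l_j ⊕₁ k is dominated in S_x, i.e., there exists l' ∈ S_x with l' ⪯'_≠ l; likewise, if l_i ⪯'_= l_j (same-node labels) and l_i ⊕ k ⊆ S_x, then every l ∈ l_j ⊕ k admits l' ∈ S_x with l' ⪯'_≠ l. Hence a label extending an inefficient label at the preceding vertex is itself dominated at x. -/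
/-- Lemma 1 (efficient substructure, contrapositive core): a label extending an
inefficient label at the preceding vertex is itself dominated in the set `Sx` of
labels of all paths reaching vertex `x`. -/
theorem lemma1 {T K : Type*} (cost : T × T → ℝ) (RI : T → Set ℤ) (oplus : T → K → Set T)
    (h2 : Assumption2 cost oplus) (hres : ResourceAssumption RI oplus)
    (Sx : Set (T × T)) (k : K) :
    (∀ li lj : T × T, precNe' cost RI li lj → oplus1 oplus li k ⊆ Sx →
      ∀ l ∈ oplus1 oplus lj k, ∃ l' ∈ Sx, precNe' cost RI l' l) ∧
    (∀ li lj : T × T, precEq' cost RI li lj → oplusBoth oplus li k ⊆ Sx →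
      ∀ l ∈ oplusBoth oplus lj k, ∃ l' ∈ Sx, precNe' cost RI l' l) := by
  constructor
  · rintro li lj ⟨hc, h₁, h₂⟩ hS _ ⟨t, ht, rfl⟩
    obtain ⟨t', ht', hr⟩ := hres _ _ h₁ k t ht
    have hmem : (t', li.2) ∈ oplus1 oplus li k := ⟨t', ht', rfl⟩
    exact ⟨_, hS hmem, (h2 li lj hc k).1 _ hmem _ ⟨t, ht, rfl⟩, hr, h₂⟩
  · rintro li lj ⟨hc, hRI⟩ hS l hl
    suffices h : ∃ l' ∈ oplusBoth oplus li k, RIsupNe RI l' l by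
      obtain ⟨l', hmem, hr⟩ := h
      exact ⟨l', hS hmem, (h2 li lj hc k).2 l' hmem l hl, hr⟩
    rcases hRI with ⟨h₁, h₂⟩ | ⟨h₁, h₂⟩ <;> rcases hl with ⟨t, ht, rfl⟩ | ⟨t, ht, rfl⟩
    · obtain ⟨t', ht', hr⟩ := hres _ _ h₁ k t ht
      exact ⟨_, Or.inl ⟨t', ht', rfl⟩, hr, h₂⟩
    · obtain ⟨t', ht', hr⟩ := hres _ _ h₂ k t ht
      exact ⟨_, Or.inr ⟨t', ht', rfl⟩, hr, h₁⟩
    · obtain ⟨t', ht', hr⟩ := hres _ _ h₂ k t ht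
      exact ⟨_, Or.inr ⟨t', ht', rfl⟩, hr, h₁⟩
    · obtain ⟨t', ht', hr⟩ := hres _ _ h₁ k t ht
      exact ⟨_, Or.inl ⟨t', ht', rfl⟩, hr, h₂⟩
end
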